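/- arXiv:1911.05383 — 7 statements merged into one kernel-verified Lean document; each statement's English description precedes it below -/
import Mathlib

section
/- Let f : ℂ → ℂ⁶ be given by f(z) = (1 + z³, i(1 − z³), √3·z − z²/√3, i(√3·z + z²/√3), √(8/3)·z², i·√(8/3)·z²). Then for every z ∈ ℂ: (i) Σ_{j=0}^{5} f_j(z)² = 0, and (ii) |f(z)|² = 2(1 + |z|²)³, where |f(z)|² = Σ_j |f_j(z)|². -/
open Complex

/-- The non-homogeneous constant-curvature holomorphic curve `f₀⁽³⁾` of equation (4.14). -/
noncomputable def fcurve (z : ℂ) : Fin 6 → ℂ :=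
  ![1 + z ^ 3, I * (1 - z ^ 3),
    (Real.sqrt 3 : ℂ) * z - z ^ 2 / (Real.sqrt 3 : ℂ),
    I * ((Real.sqrt 3 : ℂ) * z + z ^ 2 / (Real.sqrt 3 : ℂ)),
    ((Real.sqrt 8 / Real.sqrt 3 : ℝ) : ℂ) * z ^ 2,
    I * ((Real.sqrt 8 / Real.sqrt 3 : ℝ) : ℂ) * z ^ 2]

theorem stmt_6 :
    ∀ z : ℂ,
      (∑ j : Fin 6, fcurve z j ^ 2 = 0) ∧
      (∑ j : Fin 6, ‖fcurve z j‖ ^ 2 = 2 * (1 + ‖z‖ ^ 2) ^ 3) := by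
  intro z
  have h3 : Real.sqrt 3 ≠ 0 := by positivity
  have h3c : (Real.sqrt 3 : ℂ) ≠ 0 := by exact_mod_cast h3
  have h3s : Real.sqrt 3 ^ 2 = 3 := Real.sq_sqrt (by norm_num)
  have h8s : Real.sqrt 8 ^ 2 = 8 := Real.sq_sqrt (by norm_num)
  simp only [fcurve, Fin.sum_univ_six, Matrix.cons_val]
  constructor
  · have hcross : (Real.sqrt 3 : ℂ) * z * (z ^ 2 / (Real.sqrt 3 : ℂ)) = z ^ 3 := by
      field_simp
    linear_combination (-4) * hcross + ((1 - z ^ 3) ^ 2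
      + ((Real.sqrt 3 : ℂ) * z + z ^ 2 / (Real.sqrt 3 : ℂ)) ^ 2
      + (((Real.sqrt 8 / Real.sqrt 3 : ℝ) : ℂ) * z ^ 2) ^ 2) * I_sq
  · have hcubic := parallelogram_law_with_norm ℝ (1 : ℂ) (z ^ 3)
    have hmid := parallelogram_law_with_norm ℝ
      ((Real.sqrt 3 : ℂ) * z) (z ^ 2 / (Real.sqrt 3 : ℂ))
    have hlin : ‖(Real.sqrt 3 : ℂ) * z‖ ^ 2 = 3 * ‖z‖ ^ 2 := by
      rw [norm_mul, norm_real, mul_pow, Real.norm_eq_abs, sq_abs, h3s]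
    have hquad : ‖z ^ 2 / (Real.sqrt 3 : ℂ)‖ ^ 2 = ‖z‖ ^ 4 / 3 := by
      rw [norm_div, norm_real, div_pow, Real.norm_eq_abs, sq_abs, h3s, norm_pow]
      ring
    have hlast : ‖((Real.sqrt 8 / Real.sqrt 3 : ℝ) : ℂ) * z ^ 2‖ ^ 2 = 8 / 3 * ‖z‖ ^ 4 := by
      rw [norm_mul, norm_real, mul_pow, Real.norm_eq_abs, sq_abs, div_pow, h3s, h8s, norm_pow]
      ring
    rw [norm_one, norm_pow] at hcubic
    rw [mul_assoc I, norm_mul I, norm_mul I, norm_mul I, norm_I]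
    linear_combination hcubic + hmid + 2 * hlin + 2 * hquad + 2 * hlast
end

section
/- Let f : ℂ → ℂ⁶ be given by f(z) = (1 + z³, i(1 − z³), √3·z − z²/√3, i(√3·z + z²/√3), √(8/3)·z², i·√(8/3)·z²). Then for every z ∈ ℂ: Σ_{j=0}^{5} f_j′(z)² = −8z, Σ_{j=0}^{5} f_j(z)·f_j′(z) = 0, and Σ_{j=0}^{5} f_j(z)·f_j″(z) = 8z. In particular Σ_j f_j(z)·f_j″(z) vanishes only at z = 0 and is not identically zero. -/
open Complex

theorem hasDerivAt_cubic (a b c d z : ℂ) :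
    HasDerivAt (fun w : ℂ => a + b * w + c * w ^ 2 + d * w ^ 3)
      (b + 2 * c * z + 3 * d * z ^ 2) z := by
  have h := ((((hasDerivAt_id z).const_mul b).const_add a).add
    ((hasDerivAt_pow 2 z).const_mul c)).add ((hasDerivAt_pow 3 z).const_mul d)
  refine h.congr_deriv ?_
  push_cast
  ring

theorem deriv_cubic (a b c d : ℂ) :
    deriv (fun w : ℂ => a + b * w + c * w ^ 2 + d * w ^ 3) =
      fun z => b + 2 * c * z + 3 * d * z ^ 2 :=
  funext fun z => (hasDerivAt_cubic a b c d z).deriv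

theorem iteratedDeriv_two_cubic (a b c d : ℂ) :
    iteratedDeriv 2 (fun w : ℂ => a + b * w + c * w ^ 2 + d * w ^ 3) =
      fun z => 2 * c + 6 * d * z := by
  rw [iteratedDeriv_succ, iteratedDeriv_one, deriv_cubic]
  have h := deriv_cubic b (2 * c) (3 * d) 0
  simp only [zero_mul, add_zero, mul_zero] at h
  rw [h]
  funext z
  ring

/-- The coefficients of `w ^ k` in the components of `fcurve w`. -/
noncomputable def fcurveCoeff : Fin 4 → Fin 6 → ℂ :=
  ![![1, I, 0, 0, 0, 0],
    ![0, 0, (Real.sqrt 3 : ℂ), I * (Real.sqrt 3 : ℂ), 0, 0],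
    ![0, 0, -(Real.sqrt 3 : ℂ)⁻¹, I * (Real.sqrt 3 : ℂ)⁻¹,
      ((Real.sqrt 8 / Real.sqrt 3 : ℝ) : ℂ), I * ((Real.sqrt 8 / Real.sqrt 3 : ℝ) : ℂ)],
    ![1, -I, 0, 0, 0, 0]]

theorem fcurve_apply (z : ℂ) (j : Fin 6) :
    fcurve z j = fcurveCoeff 0 j + fcurveCoeff 1 j * z + fcurveCoeff 2 j * z ^ 2 +
      fcurveCoeff 3 j * z ^ 3 := by
  fin_cases j <;> simp [fcurve, fcurveCoeff] <;> ring

theorem sqrt_three_mul_inv : (Real.sqrt 3 : ℂ) * (Real.sqrt 3 : ℂ)⁻¹ = 1 :=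
  mul_inv_cancel₀ (by simp)

theorem stmt_7 :
    (∀ z : ℂ, ∑ j : Fin 6, (deriv (fun w => fcurve w j) z) ^ 2 = -8 * z) ∧
    (∀ z : ℂ, ∑ j : Fin 6, fcurve z j * deriv (fun w => fcurve w j) z = 0) ∧
    (∀ z : ℂ, ∑ j : Fin 6, fcurve z j * iteratedDeriv 2 (fun w => fcurve w j) z = 8 * z) ∧
    (∀ z : ℂ,
      (∑ j : Fin 6, fcurve z j * iteratedDeriv 2 (fun w => fcurve w j) z = 0) ↔ z = 0) := by
  have hs := sqrt_three_mul_inv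
  have hI := I_sq
  have key : ∀ z : ℂ,
      ∑ j : Fin 6, fcurve z j * iteratedDeriv 2 (fun w => fcurve w j) z = 8 * z := by
    intro z
    simp only [fcurve_apply, iteratedDeriv_two_cubic]
    simp [Fin.sum_univ_succ, fcurveCoeff, -ofReal_div]
    generalize (Real.sqrt 3 : ℂ)⁻¹ = t at *
    grind
  refine ⟨fun z => ?_, fun z => ?_, key, fun z => by rw [key]; simp⟩
  · simp only [fcurve_apply, deriv_cubic]
    simp [Fin.sum_univ_succ, fcurveCoeff, -ofReal_div]
    generalize (Real.sqrt 3 : ℂ)⁻¹ = t at *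
    grind
  · simp only [fcurve_apply, deriv_cubic]
    simp [Fin.sum_univ_succ, fcurveCoeff, -ofReal_div]
    generalize (Real.sqrt 3 : ℂ)⁻¹ = t at *
    grind
end

section
/- Let f(z) = (1 + z³, i(1 − z³), √3·z − z²/√3, i(√3·z + z²/√3), √(8/3)·z², i·√(8/3)·z²) and let f₁(z) = f′(z) − (⟨f′(z), f(z)⟩/|f(z)|²)·f(z) be its first derived curve. Then for every z ∈ ℂ: ⟨f′(z), f(z)⟩ = 6·conj(z)·(1 + |z|²)², |f₁(z)|² = 6(1 + |z|²), and Σ_{j=0}^{5} (f₁)_j(z)² = −8z. -/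
open Complex

/-- The Hermitian inner product `⟨x, y⟩ = Σⱼ xⱼ · conj(yⱼ)` on `ℂ⁶`. -/
noncomputable def hermIP (x y : Fin 6 → ℂ) : ℂ :=
  ∑ j : Fin 6, x j * (starRingEnd ℂ) (y j)

/-- The derivative `f′` of the curve `f₀⁽³⁾`. -/
noncomputable def fcurve' (z : ℂ) : Fin 6 → ℂ :=
  fun j => deriv (fun w => fcurve w j) z

/-- The first derived (Frenet) curve `f₁ = f′ − (⟨f′, f⟩ / |f|²) · f`. -/
noncomputable def fcurveOne (z : ℂ) : Fin 6 → ℂ :=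
  fun j => fcurve' z j - (hermIP (fcurve' z) (fcurve z) / hermIP (fcurve z) (fcurve z)) * fcurve z j

theorem ofReal_sqrt_three_sq : (Real.sqrt 3 : ℂ) ^ 2 = 3 := by
  rw [← ofReal_pow, Real.sq_sqrt (by norm_num)]
  norm_num

theorem ofReal_sqrt_eight_sq : (Real.sqrt 8 : ℂ) ^ 2 = 8 := by
  rw [← ofReal_pow, Real.sq_sqrt (by norm_num)]
  norm_num

theorem ofReal_sqrt_three_ne_zero : (Real.sqrt 3 : ℂ) ≠ 0 := by
  rw [ofReal_ne_zero]
  positivity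

theorem fcurve'_eq (z : ℂ) :
    fcurve' z = ![3 * z ^ 2, -I * (3 * z ^ 2),
      (Real.sqrt 3 : ℂ) - 2 * z / (Real.sqrt 3 : ℂ),
      I * ((Real.sqrt 3 : ℂ) + 2 * z / (Real.sqrt 3 : ℂ)),
      ((Real.sqrt 8 / Real.sqrt 3 : ℝ) : ℂ) * (2 * z),
      I * ((Real.sqrt 8 / Real.sqrt 3 : ℝ) : ℂ) * (2 * z)] := by
  have h1 := hasDerivAt_id z
  have h2 : HasDerivAt (fun w : ℂ => w ^ 2) (2 * z) z := by simpa using hasDerivAt_pow 2 z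
  have h3 : HasDerivAt (fun w : ℂ => w ^ 3) (3 * z ^ 2) z := by simpa using hasDerivAt_pow 3 z
  funext j
  fin_cases j
  · exact (h3.const_add 1).deriv
  · exact ((h3.const_sub 1).const_mul I).deriv.trans (by simp)
  · exact ((h1.const_mul _).sub (h2.div_const _)).deriv.trans (by simp)
  · exact (((h1.const_mul _).add (h2.div_const _)).const_mul I).deriv.trans (by simp)
  · exact (h2.const_mul _).deriv
  · exact (h2.const_mul _).deriv

theorem hermIP_fcurve_self (z : ℂ) :
    hermIP (fcurve z) (fcurve z) = 2 * (1 + z * (starRingEnd ℂ) z) ^ 3 := by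
  have h3 := ofReal_sqrt_three_sq
  have h8 := ofReal_sqrt_eight_sq
  have h0 := ofReal_sqrt_three_ne_zero
  simp only [hermIP, fcurve, Fin.sum_univ_six, Matrix.cons_val, map_add, map_sub, map_mul, map_div₀,
    map_pow, map_one, conj_I, conj_ofReal, ofReal_div]
  field_simp
  grind [I_sq]

theorem hermIP_fcurve'_fcurve (z : ℂ) :
    hermIP (fcurve' z) (fcurve z) =
      6 * (starRingEnd ℂ) z * (1 + z * (starRingEnd ℂ) z) ^ 2 := by
  have h3 := ofReal_sqrt_three_sq
  have h8 := ofReal_sqrt_eight_sq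
  have h0 := ofReal_sqrt_three_ne_zero
  simp only [hermIP, fcurve'_eq, fcurve, Fin.sum_univ_six, Matrix.cons_val, map_add, map_sub,
    map_mul, map_div₀, map_pow, map_one, conj_I, conj_ofReal, ofReal_div]
  field_simp
  grind [I_sq]

theorem hermIP_fcurve'_self (z : ℂ) :
    hermIP (fcurve' z) (fcurve' z) =
      6 + 24 * (z * (starRingEnd ℂ) z) + 18 * (z * (starRingEnd ℂ) z) ^ 2 := by
  have h3 := ofReal_sqrt_three_sq
  have h8 := ofReal_sqrt_eight_sq
  have h0 := ofReal_sqrt_three_ne_zero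
  simp only [hermIP, fcurve'_eq, Fin.sum_univ_six, Matrix.cons_val, map_add, map_sub, map_neg,
    map_mul, map_div₀, map_pow, conj_I, conj_ofReal, ofReal_div, map_ofNat]
  field_simp
  grind [I_sq]

theorem sum_sq_fcurve'_sub_mul_fcurve (z c : ℂ) :
    ∑ j, (fcurve' z j - c * fcurve z j) ^ 2 = -8 * z := by
  have h3 := ofReal_sqrt_three_sq
  have h0 := ofReal_sqrt_three_ne_zero
  simp only [fcurve'_eq, fcurve, Fin.sum_univ_six, Matrix.cons_val]
  field_simp
  grind [I_sq]

theorem conj_hermIP (x y : Fin 6 → ℂ) : (starRingEnd ℂ) (hermIP x y) = hermIP y x := by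
  simp [hermIP, mul_comm]

theorem hermIP_sub_mul_self (x y : Fin 6 → ℂ) (c : ℂ) :
    hermIP (fun j => x j - c * y j) (fun j => x j - c * y j) =
      hermIP x x - (starRingEnd ℂ) c * hermIP x y - c * hermIP y x
        + c * (starRingEnd ℂ) c * hermIP y y := by
  simp only [hermIP, Finset.mul_sum, ← Finset.sum_sub_distrib, ← Finset.sum_add_distrib, map_sub,
    map_mul]
  exact Finset.sum_congr rfl fun j _ => by ring

theorem ofReal_sum_norm_sq (x : Fin 6 → ℂ) : ((∑ j, ‖x j‖ ^ 2 : ℝ) : ℂ) = hermIP x x := by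
  simp [hermIP, mul_conj']

theorem one_add_mul_conj_ne_zero (z : ℂ) : 1 + z * (starRingEnd ℂ) z ≠ 0 := by
  rw [mul_conj']
  exact_mod_cast (by positivity : (1 + ‖z‖ ^ 2 : ℝ) ≠ 0)

theorem hermIP_fcurveOne_self (z : ℂ) :
    hermIP (fcurveOne z) (fcurveOne z) = 6 * (1 + z * (starRingEnd ℂ) z) := by
  have h := one_add_mul_conj_ne_zero z
  have hc : hermIP (fcurve' z) (fcurve z) / hermIP (fcurve z) (fcurve z) =
      3 * (starRingEnd ℂ) z / (1 + z * (starRingEnd ℂ) z) := by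
    rw [hermIP_fcurve'_fcurve, hermIP_fcurve_self]
    rw [div_eq_div_iff (mul_ne_zero two_ne_zero (pow_ne_zero 3 h)) h]
    ring
  unfold fcurveOne
  rw [hermIP_sub_mul_self, hc, ← conj_hermIP (fcurve' z) (fcurve z), hermIP_fcurve'_fcurve,
    hermIP_fcurve_self, hermIP_fcurve'_self]
  simp only [map_mul, map_div₀, map_add, map_pow, map_one, map_ofNat, conj_conj,
    mul_comm ((starRingEnd ℂ) z) z]
  field_simp
  ring

theorem stmt_8 :
    ∀ z : ℂ,
      hermIP (fcurve' z) (fcurve z) = 6 * (starRingEnd ℂ) z * (((1 + ‖z‖ ^ 2 : ℝ) : ℂ)) ^ 2 ∧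
      (∑ j : Fin 6, ‖fcurveOne z j‖ ^ 2 = 6 * (1 + ‖z‖ ^ 2)) ∧
      (∑ j : Fin 6, fcurveOne z j ^ 2 = -8 * z) := by
  intro z
  refine ⟨?_, ?_, sum_sq_fcurve'_sub_mul_fcurve z _⟩
  · rw [hermIP_fcurve'_fcurve, mul_conj']
    push_cast
    rfl
  · apply ofReal_injective
    rw [ofReal_sum_norm_sq, hermIP_fcurveOne_self, mul_conj']
    push_cast
    rfl
end

section
/- Let F : ℂ → ℂ⁶ be given by F(z) = (−√2·conj(z), −i√2·conj(z), 1 − |z|², i(1 − |z|²), √2·z, i√2·z), and let h(z) = (1, i, √2·z, i√2·z, z², i·z²) with first derived curve h₁(z) = h′(z) − (⟨h′(z), h(z)⟩/|h(z)|²)·h(z). Then for every z ∈ ℂ: (i) Σ_{j=0}^{5} F_j(z)² = 0; (ii) |F(z)|² = 2(1 + |z|²)²; and (iii) F(z) = ((1 + |z|²)/√2)·h₁(z). -/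
open Complex

/-- The strongly isotropic holomorphic curve `f₀⁽²⁾` of equation (4.20). -/
noncomputable def hcurve (z : ℂ) : Fin 6 → ℂ :=
  ![1, I, (Real.sqrt 2 : ℂ) * z, I * (Real.sqrt 2 : ℂ) * z, z ^ 2, I * z ^ 2]

/-- The derivative `h′` of the curve. -/
noncomputable def hcurve' (z : ℂ) : Fin 6 → ℂ :=
  fun j => deriv (fun w => hcurve w j) z

/-- The first derived (Frenet) curve `h₁ = h′ − (⟨h′, h⟩ / |h|²) · h`. -/
noncomputable def hcurveOne (z : ℂ) : Fin 6 → ℂ :=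
  fun j => hcurve' z j - (hermIP (hcurve' z) (hcurve z) / hermIP (hcurve z) (hcurve z)) * hcurve z j

/-- The curve `f₁⁽²⁾ = U₀V₁⁽²⁾` of equation (5.21). -/
noncomputable def Fcurve (z : ℂ) : Fin 6 → ℂ :=
  ![-(Real.sqrt 2 : ℂ) * (starRingEnd ℂ) z,
    -I * (Real.sqrt 2 : ℂ) * (starRingEnd ℂ) z,
    ((1 - ‖z‖ ^ 2 : ℝ) : ℂ),
    I * ((1 - ‖z‖ ^ 2 : ℝ) : ℂ),
    (Real.sqrt 2 : ℂ) * z, I * (Real.sqrt 2 : ℂ) * z]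

theorem ofReal_sqrt_two_sq : (Real.sqrt 2 : ℂ) ^ 2 = 2 := by
  norm_cast
  simp

theorem ofReal_sqrt_two_ne_zero : (Real.sqrt 2 : ℂ) ≠ 0 := by
  simp

theorem hcurve'_eq (z : ℂ) :
    hcurve' z = ![0, 0, (Real.sqrt 2 : ℂ), I * (Real.sqrt 2 : ℂ), 2 * z, I * (2 * z)] := by
  funext j
  fin_cases j <;> simp [hcurve', hcurve, deriv_const_mul_id']

theorem hermIP_hcurve_self (z : ℂ) :
    hermIP (hcurve z) (hcurve z) = 2 * (1 + z * (starRingEnd ℂ) z) ^ 2 := by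
  simp [hermIP, hcurve, Fin.sum_univ_six]
  linear_combination (2 * z * (starRingEnd ℂ) z) * ofReal_sqrt_two_sq +
    (-(Real.sqrt 2 : ℂ) ^ 2 * z * (starRingEnd ℂ) z - z ^ 2 * (starRingEnd ℂ) z ^ 2) * I_sq

theorem hermIP_hcurve'_hcurve (z : ℂ) :
    hermIP (hcurve' z) (hcurve z) =
      4 * (starRingEnd ℂ) z * (1 + z * (starRingEnd ℂ) z) := by
  simp [hermIP, hcurve'_eq, hcurve, Fin.sum_univ_six]
  linear_combination (2 * (starRingEnd ℂ) z) * ofReal_sqrt_two_sq +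
    (-(Real.sqrt 2 : ℂ) ^ 2 * (starRingEnd ℂ) z - 2 * z * (starRingEnd ℂ) z ^ 2) * I_sq

theorem hcurveOne_apply (z : ℂ) (j : Fin 6) :
    hcurveOne z j =
      hcurve' z j - 2 * (starRingEnd ℂ) z / (1 + z * (starRingEnd ℂ) z) * hcurve z j := by
  have h := one_add_mul_conj_ne_zero z
  rw [hcurveOne, hermIP_hcurve_self, hermIP_hcurve'_hcurve]
  field_simp
  ring

theorem sum_Fcurve_sq (z : ℂ) : ∑ j : Fin 6, Fcurve z j ^ 2 = 0 := by
  simp [Fcurve, Fin.sum_univ_six, mul_pow]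

theorem sum_norm_Fcurve_sq (z : ℂ) :
    ∑ j : Fin 6, ‖Fcurve z j‖ ^ 2 = 2 * (1 + ‖z‖ ^ 2) ^ 2 := by
  have h : ‖(1 - (‖z‖ : ℂ) ^ 2)‖ ^ 2 = (1 - ‖z‖ ^ 2) ^ 2 := by
    rw [← sq_abs (1 - ‖z‖ ^ 2), ← Real.norm_eq_abs, ← norm_real]
    push_cast
    rfl
  simp [Fcurve, Fin.sum_univ_six, mul_pow, h]
  ring

theorem Fcurve_eq_smul_hcurveOne (z : ℂ) (j : Fin 6) :
    Fcurve z j = (((1 + ‖z‖ ^ 2 : ℝ) : ℂ) / (Real.sqrt 2 : ℂ)) * hcurveOne z j := by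
  have h := one_add_mul_conj_ne_zero z
  have hs := ofReal_sqrt_two_ne_zero
  have hsq := ofReal_sqrt_two_sq
  rw [hcurveOne_apply, hcurve'_eq]
  fin_cases j <;> simp [Fcurve, hcurve, ← mul_conj'] <;> field_simp <;> grind

theorem stmt_11 :
    ∀ z : ℂ,
      (∑ j : Fin 6, Fcurve z j ^ 2 = 0) ∧
      (∑ j : Fin 6, ‖Fcurve z j‖ ^ 2 = 2 * (1 + ‖z‖ ^ 2) ^ 2) ∧
      (∀ j : Fin 6,
        Fcurve z j = (((1 + ‖z‖ ^ 2 : ℝ) : ℂ) / (Real.sqrt 2 : ℂ)) * hcurveOne z j) := by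
  exact fun z => ⟨sum_Fcurve_sq z, sum_norm_Fcurve_sq z, Fcurve_eq_smul_hcurveOne z⟩
end

section
/- Let a, b, c, d, p, q, r, s be complex polynomials and set f(z) = (1, 0, a(z), b(z), c(z), d(z)) and g(z) = (0, 1, p(z), q(z), r(z), s(z)) in ℂ⁶. Assume Σ_{0 ≤ i < j ≤ 5} |f_i(z)g_j(z) − f_j(z)g_i(z)|² = (1 + |z|²)⁴ for all z ∈ ℂ. Then each of the eight polynomials a, b, c, d, p, q, r, s has degree at most 4, and, writing a₄, b₄, c₄, d₄, p₄, q₄, r₄, s₄ for their coefficients of z⁴, all 2×2 minors of the matrix with rows (a₄, b₄, c₄, d₄) and (p₄, q₄, r₄, s₄) vanish: a₄q₄ = b₄p₄, a₄r₄ = c₄p₄, a₄s₄ = d₄p₄, b₄r₄ = c₄q₄, b₄s₄ = d₄q₄, c₄s₄ = d₄r₄. -/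
open Complex Polynomial

/-- A complex polynomial `P` with `‖P z‖ ^ 2 ≤ (1 + ‖z‖ ^ 2) ^ k` for all `z` has degree at
most `k`. -/
lemma Polynomial.natDegree_le_of_sq_norm_eval_le (P : Polynomial ℂ) (k : ℕ)
    (h : ∀ z : ℂ, ‖P.eval z‖ ^ 2 ≤ (1 + ‖z‖ ^ 2) ^ k) : P.natDegree ≤ k := by
  by_contra! hk
  have hrev : ∀ w : ℂ, w ≠ 0 → ‖P.reverse.eval w‖ ^ 2 ≤
      ‖w‖ ^ (2 * (P.natDegree - k)) * (‖w‖ ^ 2 + 1) ^ k := by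
    intro w hw
    have hw' : ‖w‖ ≠ 0 := norm_ne_zero_iff.mpr hw
    have : Invertible w⁻¹ := invertibleOfNonzero (inv_ne_zero hw)
    have e := eval₂_reverse_mul_pow (RingHom.id ℂ) w⁻¹ P
    rw [invOf_eq_inv, inv_inv, eval₂_id, eval₂_id] at e
    have e' : P.reverse.eval w = P.eval w⁻¹ * w ^ P.natDegree := by
      rw [← e, inv_pow, inv_mul_cancel_right₀ (pow_ne_zero _ hw)]
    obtain ⟨m, hm⟩ := Nat.exists_eq_add_of_le hk.le
    calc ‖P.reverse.eval w‖ ^ 2 = ‖P.eval w⁻¹‖ ^ 2 * (‖w‖ ^ P.natDegree) ^ 2 := by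
          rw [e', norm_mul, norm_pow, mul_pow]
      _ ≤ (1 + ‖w⁻¹‖ ^ 2) ^ k * (‖w‖ ^ P.natDegree) ^ 2 := by gcongr; exact h _
      _ = ‖w‖ ^ (2 * m) * ((1 + ‖w⁻¹‖ ^ 2) * ‖w‖ ^ 2) ^ k := by
          rw [hm, mul_pow]; ring
      _ = ‖w‖ ^ (2 * (P.natDegree - k)) * (‖w‖ ^ 2 + 1) ^ k := by
          rw [hm, Nat.add_sub_cancel_left, norm_inv]
          congr 2
          field_simp
  have h0 : ‖P.reverse.eval 0‖ ^ 2 ≤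
      ‖(0 : ℂ)‖ ^ (2 * (P.natDegree - k)) * (‖(0 : ℂ)‖ ^ 2 + 1) ^ k := by
    have hl : Continuous fun w : ℂ => ‖P.reverse.eval w‖ ^ 2 := by fun_prop
    have hr : Continuous fun w : ℂ =>
        ‖w‖ ^ (2 * (P.natDegree - k)) * (‖w‖ ^ 2 + 1) ^ k := by fun_prop
    exact le_of_tendsto_of_tendsto (hl.tendsto 0 |>.mono_left nhdsWithin_le_nhds)
      (hr.tendsto 0 |>.mono_left nhdsWithin_le_nhds)
      (eventually_nhdsWithin_of_forall (s := {0}ᶜ) hrev)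
  rw [norm_zero, zero_pow (by lia), zero_mul, ← coeff_zero_eq_eval_zero,
    coeff_zero_reverse] at h0
  have hlead : P.leadingCoeff = 0 := by
    simpa using le_antisymm h0 (sq_nonneg _)
  simp [leadingCoeff_eq_zero.mp hlead] at hk

/-- If `u * y - v * x` has degree less than `2 * k` and all four factors have degree at most `k`,
then the corresponding minor of coefficients of degree `k` vanishes. -/
lemma Polynomial.coeff_mul_coeff_eq_of_natDegree_sub_lt {R : Type*} [CommRing R]
    {u v x y : Polynomial R} {k : ℕ} (hu : u.natDegree ≤ k) (hv : v.natDegree ≤ k)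
    (hx : x.natDegree ≤ k) (hy : y.natDegree ≤ k)
    (h : (u * y - v * x).natDegree < k + k) :
    u.coeff k * y.coeff k = v.coeff k * x.coeff k := by
  have := coeff_eq_zero_of_natDegree_lt h
  rwa [coeff_sub, coeff_mul_add_eq_of_natDegree_le hu hy,
    coeff_mul_add_eq_of_natDegree_le hv hx, sub_eq_zero] at this

theorem stmt_13 (a b c d p q r s : Polynomial ℂ)
    (f g : ℂ → Fin 6 → ℂ)
    (hf : ∀ z, f z = ![1, 0, a.eval z, b.eval z, c.eval z, d.eval z])
    (hg : ∀ z, g z = ![0, 1, p.eval z, q.eval z, r.eval z, s.eval z])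
    (hnorm : ∀ z : ℂ,
      ∑ ij ∈ Finset.univ.filter (fun ij : Fin 6 × Fin 6 => ij.1 < ij.2),
        ‖f z ij.1 * g z ij.2 - f z ij.2 * g z ij.1‖ ^ 2 = (1 + ‖z‖ ^ 2) ^ 4) :
    (a.natDegree ≤ 4 ∧ b.natDegree ≤ 4 ∧ c.natDegree ≤ 4 ∧ d.natDegree ≤ 4 ∧
      p.natDegree ≤ 4 ∧ q.natDegree ≤ 4 ∧ r.natDegree ≤ 4 ∧ s.natDegree ≤ 4) ∧
    (a.coeff 4 * q.coeff 4 = b.coeff 4 * p.coeff 4 ∧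
      a.coeff 4 * r.coeff 4 = c.coeff 4 * p.coeff 4 ∧
      a.coeff 4 * s.coeff 4 = d.coeff 4 * p.coeff 4 ∧
      b.coeff 4 * r.coeff 4 = c.coeff 4 * q.coeff 4 ∧
      b.coeff 4 * s.coeff 4 = d.coeff 4 * q.coeff 4 ∧
      c.coeff 4 * s.coeff 4 = d.coeff 4 * r.coeff 4) := by
  have key : ∀ i j : Fin 6, i < j → ∀ P : Polynomial ℂ,
      (∀ z, ‖P.eval z‖ = ‖f z i * g z j - f z j * g z i‖) → P.natDegree ≤ 4 := by
    intro i j hij P hP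
    refine natDegree_le_of_sq_norm_eval_le P 4 fun z => ?_
    have hmem : (i, j) ∈ Finset.univ.filter (fun ij : Fin 6 × Fin 6 => ij.1 < ij.2) :=
      Finset.mem_filter.mpr ⟨Finset.mem_univ _, hij⟩
    have hle := Finset.single_le_sum
      (f := fun ij : Fin 6 × Fin 6 => ‖f z ij.1 * g z ij.2 - f z ij.2 * g z ij.1‖ ^ 2)
      (fun _ _ => sq_nonneg _) hmem
    rw [hnorm z] at hle
    rw [hP z]
    exact hle
  have ha : a.natDegree ≤ 4 := key 1 2 (by decide) _ fun z => by simp [hf, hg]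
  have hb : b.natDegree ≤ 4 := key 1 3 (by decide) _ fun z => by simp [hf, hg]
  have hc : c.natDegree ≤ 4 := key 1 4 (by decide) _ fun z => by simp [hf, hg]
  have hd : d.natDegree ≤ 4 := key 1 5 (by decide) _ fun z => by simp [hf, hg]
  have hp : p.natDegree ≤ 4 := key 0 2 (by decide) _ fun z => by simp [hf, hg]
  have hq : q.natDegree ≤ 4 := key 0 3 (by decide) _ fun z => by simp [hf, hg]
  have hr : r.natDegree ≤ 4 := key 0 4 (by decide) _ fun z => by simp [hf, hg]
  have hs : s.natDegree ≤ 4 := key 0 5 (by decide) _ fun z => by simp [hf, hg]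
  refine ⟨⟨ha, hb, hc, hd, hp, hq, hr, hs⟩, ?_, ?_, ?_, ?_, ?_, ?_⟩
  · exact coeff_mul_coeff_eq_of_natDegree_sub_lt ha hb hp hq <|
      (key 2 3 (by decide) _ fun z => by simp [hf, hg]).trans_lt (by norm_num)
  · exact coeff_mul_coeff_eq_of_natDegree_sub_lt ha hc hp hr <|
      (key 2 4 (by decide) _ fun z => by simp [hf, hg]).trans_lt (by norm_num)
  · exact coeff_mul_coeff_eq_of_natDegree_sub_lt ha hd hp hs <|
      (key 2 5 (by decide) _ fun z => by simp [hf, hg]).trans_lt (by norm_num)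
  · exact coeff_mul_coeff_eq_of_natDegree_sub_lt hb hc hq hr <|
      (key 3 4 (by decide) _ fun z => by simp [hf, hg]).trans_lt (by norm_num)
  · exact coeff_mul_coeff_eq_of_natDegree_sub_lt hb hd hq hs <|
      (key 3 5 (by decide) _ fun z => by simp [hf, hg]).trans_lt (by norm_num)
  · exact coeff_mul_coeff_eq_of_natDegree_sub_lt hc hd hr hs <|
      (key 4 5 (by decide) _ fun z => by simp [hf, hg]).trans_lt (by norm_num)
end

section
/- Let n ≥ 1, let F₀ : ℂ → ℂⁿ have polynomial components, let H : ℂ → ℂⁿ be the componentwise polynomial antiderivative of F₀ with H(0) = 0, set q(z) = Σ_{j=1}^{n} H_j(z)², and define F₁ : ℂ → ℂ^{n+2} by F₁(z) = (2H₁(z), …, 2Hₙ(z), 1 − q(z), i(1 + q(z))). Then for every z ∈ ℂ: (i) the sum of the squares of the components of F₁(z) equals 0; (ii) |F₁(z)|² = 4Σ_j |H_j(z)|² + 2 + 2|q(z)|² ≥ 2, so F₁ is nowhere zero; and (iii) the sum of the squares of the components of F₁′(z) equals 4·Σ_{j=1}^{n} F₀ⱼ(z)². In particular, if Σ_j F₀ⱼ(z)²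 ≠ 0 for all z, then Σ_j F₁ⱼ(z)·F₁ⱼ″(z) = −4·Σ_j F₀ⱼ(z)² never vanishes. -/
open Complex Polynomial

theorem deriv_of_eq_eval {f : ℂ → ℂ} {p : ℂ[X]} (h : ∀ w, f w = p.eval w) :
    deriv f = fun z => (derivative p).eval z := by
  rw [funext h]
  exact funext fun z => p.deriv

theorem iteratedDeriv_two_of_eq_eval {f : ℂ → ℂ} {p : ℂ[X]} (h : ∀ w, f w = p.eval w) :
    iteratedDeriv 2 f = fun z => (derivative (derivative p)).eval z := by
  rw [iteratedDeriv_succ, iteratedDeriv_one, deriv_of_eq_eval h, deriv_of_eq_eval fun _ => rfl]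

theorem norm_one_sub_sq_add_norm_one_add_sq (q : ℂ) :
    ‖1 - q‖ ^ 2 + ‖1 + q‖ ^ 2 = 2 + 2 * ‖q‖ ^ 2 := by
  have h := parallelogram_law_with_norm ℝ (1 : ℂ) q
  rw [norm_one] at h
  linarith

theorem stmt_14 (n : ℕ) (hn : 1 ≤ n)
    (F₀ H : Fin n → Polynomial ℂ)
    (hder : ∀ j, derivative (H j) = F₀ j)
    (h0 : ∀ j, (H j).eval 0 = 0)
    (Q : ℂ → ℂ) (hQ : ∀ z, Q z = ∑ j : Fin n, (H j).eval z ^ 2)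
    (F₁ : ℂ → Fin (n + 2) → ℂ)
    (hF₁ : ∀ z, F₁ z =
      Fin.snoc (Fin.snoc (fun j : Fin n => 2 * (H j).eval z) (1 - Q z)) (I * (1 + Q z))) :
    (∀ z : ℂ, ∑ j : Fin (n + 2), F₁ z j ^ 2 = 0) ∧
    (∀ z : ℂ,
      (∑ j : Fin (n + 2), ‖F₁ z j‖ ^ 2 =
        4 * ∑ j : Fin n, ‖(H j).eval z‖ ^ 2 + 2 + 2 * ‖Q z‖ ^ 2) ∧
      2 ≤ ∑ j : Fin (n + 2), ‖F₁ z j‖ ^ 2 ∧ F₁ z ≠ 0) ∧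
    (∀ z : ℂ, ∑ j : Fin (n + 2), (deriv (fun w => F₁ w j) z) ^ 2 =
      4 * ∑ j : Fin n, (F₀ j).eval z ^ 2) ∧
    ((∀ z : ℂ, ∑ j : Fin n, (F₀ j).eval z ^ 2 ≠ 0) →
      ∀ z : ℂ,
        (∑ j : Fin (n + 2), F₁ z j * iteratedDeriv 2 (fun w => F₁ w j) z =
          -4 * ∑ j : Fin n, (F₀ j).eval z ^ 2) ∧
        ∑ j : Fin (n + 2), F₁ z j * iteratedDeriv 2 (fun w => F₁ w j) z ≠ 0) := by
  have hinner (z : ℂ) (j : Fin n) : F₁ z j.castSucc.castSucc = (2 * H j).eval z := by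
    rw [hF₁, Fin.snoc_castSucc, Fin.snoc_castSucc]
    simp
  set q : ℂ[X] := ∑ j, H j ^ 2 with hq
  have hQq (z : ℂ) : Q z = q.eval z := by simp [hQ, hq, eval_finsetSum]
  have hpenult (z : ℂ) : F₁ z (Fin.last n).castSucc = (1 - q).eval z := by
    rw [hF₁, Fin.snoc_castSucc, Fin.snoc_last]
    simp [hQq]
  have hlast (z : ℂ) : F₁ z (Fin.last (n + 1)) = (C I * (1 + q)).eval z := by
    rw [hF₁, Fin.snoc_last]
    simp [hQq]
  have hnorm (z : ℂ) : ∑ j : Fin (n + 2), ‖F₁ z j‖ ^ 2 =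
      4 * ∑ j : Fin n, ‖(H j).eval z‖ ^ 2 + 2 + 2 * ‖Q z‖ ^ 2 := by
    have h := norm_one_sub_sq_add_norm_one_add_sq (q.eval z)
    simp only [Fin.sum_univ_castSucc, hinner, hpenult, hlast, hQq]
    simp only [eval_mul, eval_ofNat, eval_sub, eval_add, eval_one, eval_C, norm_mul, norm_I,
      one_mul, mul_pow, ← Finset.mul_sum, Complex.norm_ofNat]
    linarith
  have htwo (z : ℂ) : 2 ≤ ∑ j : Fin (n + 2), ‖F₁ z j‖ ^ 2 := by
    rw [hnorm]
    have : 0 ≤ ∑ j : Fin n, ‖(H j).eval z‖ ^ 2 := by positivity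
    nlinarith [sq_nonneg ‖Q z‖]
  have hsecond (z : ℂ) : ∑ j : Fin (n + 2), F₁ z j * iteratedDeriv 2 (fun w => F₁ w j) z =
      -4 * ∑ j : Fin n, (F₀ j).eval z ^ 2 := by
    have hq'' : (derivative (derivative q)).eval z =
        2 * ∑ j, (F₀ j).eval z ^ 2
          + 2 * ∑ j, (H j).eval z * (derivative (F₀ j)).eval z := by
      simp only [hq, derivative_sum, eval_finsetSum, Finset.mul_sum, ← Finset.sum_add_distrib]
      refine Finset.sum_congr rfl fun j _ => ?_
      simp [derivative_pow, hder]
      ring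
    have hsum : ∑ j, 2 * (H j).eval z * (2 * (derivative (F₀ j)).eval z) =
        4 * ∑ j, (H j).eval z * (derivative (F₀ j)).eval z := by
      rw [Finset.mul_sum]
      exact Finset.sum_congr rfl fun j _ => by ring
    simp only [Fin.sum_univ_castSucc, iteratedDeriv_two_of_eq_eval (hinner · _),
      iteratedDeriv_two_of_eq_eval hpenult, iteratedDeriv_two_of_eq_eval hlast]
    simp only [hinner, hpenult, hlast]
    simp [hder, hq'', hsum]
    linear_combination (1 + q.eval z) * (2 * ∑ j, (F₀ j).eval z ^ 2
          + 2 * ∑ j, (H j).eval z * (derivative (F₀ j)).eval z) * I_sq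
  refine ⟨fun z => ?_, fun z => ⟨hnorm z, htwo z, fun hz => ?_⟩, fun z => ?_,
    fun hne z => ⟨hsecond z, ?_⟩⟩
  · have hqz : q.eval z = ∑ j, (H j).eval z ^ 2 := by rw [← hQq, hQ]
    simp only [Fin.sum_univ_castSucc, hinner, hpenult, hlast]
    simp only [eval_mul, eval_ofNat, eval_sub, eval_add, eval_one, eval_C, mul_pow,
      ← Finset.mul_sum, ← hqz, I_sq]
    ring
  · have h := htwo z
    norm_num [hz] at h
  · simp only [Fin.sum_univ_castSucc, deriv_of_eq_eval (hinner · _), deriv_of_eq_eval hpenult,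
      deriv_of_eq_eval hlast]
    simp only [derivative_mul, derivative_sub, derivative_add, derivative_one, derivative_C,
      derivative_ofNat, hder, eval_mul, eval_neg, eval_C, eval_ofNat,
      zero_mul, zero_add, zero_sub, mul_pow, ← Finset.mul_sum, I_sq]
    ring
  · rw [hsecond]
    exact mul_ne_zero (by norm_num) (hne z)
end

section
/- Let f : ℂ → ℂ⁶ have polynomial components each of degree at most 2, with f(z) ≠ 0 for all z ∈ ℂ, and suppose the coefficient of z²·conj(z)² in |f(z)|² = Σ_j |f_j(z)|² (regarded as a polynomial in z and conj(z)) is nonzero. If there exists a polynomial function P in z and conj(z) such that P(z, conj(z))·|f(z)|² = (1 + |z|²)⁴ for all z ∈ ℂ, then there is a real number μ > 0 with |f(z)|² = μ·(1 + |z|²)² for all z ∈ ℂ. -/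
open Complex Polynomial

/-- A polynomial in `z` and `conj z` that vanishes for all `z` vanishes identically. -/
lemma mvPolynomial_eq_zero_of_eval_conj (R : MvPolynomial (Fin 2) ℂ)
    (h : ∀ z : ℂ, MvPolynomial.eval ![z, (starRingEnd ℂ) z] R = 0) : R = 0 := by
  let φ : Fin 2 → MvPolynomial (Fin 2) ℂ :=
    ![MvPolynomial.X 0 + MvPolynomial.C I * MvPolynomial.X 1,
      MvPolynomial.X 0 - MvPolynomial.C I * MvPolynomial.X 1]
  have eval_bind (v : Fin 2 → ℂ) : MvPolynomial.eval v (MvPolynomial.bind₁ φ R) =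
      MvPolynomial.eval ![v 0 + I * v 1, v 0 - I * v 1] R := by
    rw [← MvPolynomial.coe_aeval_eq_eval, RingHom.coe_coe, MvPolynomial.aeval_bind₁,
      ← MvPolynomial.coe_aeval_eq_eval, RingHom.coe_coe]
    congr 2
    funext i
    fin_cases i <;> simp [φ]
  have hbind : MvPolynomial.bind₁ φ R = 0 := by
    refine MvPolynomial.funext_set (fun _ => Set.range ((↑) : ℝ → ℂ))
      (fun _ => Set.infinite_range_of_injective ofReal_injective) fun v hv => ?_
    obtain ⟨x, hx⟩ := hv 0 trivial
    obtain ⟨y, hy⟩ := hv 1 trivial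
    rw [eval_bind, map_zero, ← h (x + I * y), ← hx, ← hy]
    simp [sub_eq_add_neg]
  refine MvPolynomial.funext fun v => ?_
  have hv := eval_bind ![(v 0 + v 1) / 2, (v 0 - v 1) / (2 * I)]
  rw [hbind, map_zero] at hv
  rw [map_zero, hv]
  congr 2
  funext i
  fin_cases i <;> simp <;> field_simp <;> ring

/-- A quadratic divisor of a power of the linear polynomial `1 + a X` is a multiple of its
square. -/
lemma eq_C_mul_sq_of_dvd_pow {K : Type*} [Field K] {a : K} (ha : a ≠ 0) {q : K[X]}
    (hq : q.natDegree = 2) {n : ℕ} (hdvd : q ∣ (1 + C a * X) ^ n) :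
    ∃ u : K, q = C u * (1 + C a * X) ^ 2 := by
  have hdeg : (1 + C a * X : K[X]).natDegree = 1 := by
    rw [add_comm, ← C_1, natDegree_linear ha]
  have hprime : Prime (1 + C a * X : K[X]) := by
    refine (irreducible_of_degree_eq_one ?_).prime
    rw [add_comm, ← C_1, degree_linear ha]
  obtain ⟨k, -, hk⟩ := (dvd_prime_pow hprime n).1 hdvd
  have hk2 : k = 2 := by
    rw [← hq, natDegree_eq_of_degree_eq (degree_eq_degree_of_associated hk), natDegree_pow, hdeg,
      mul_one]
  subst hk2
  obtain ⟨u, hu⟩ := hk.symm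
  obtain ⟨c, -, hc⟩ := isUnit_iff.1 u.isUnit
  exact ⟨c, by rw [← hu, ← hc, mul_comm]⟩

/-- The polynomial `w ↦ ∑ j, f j z * conj (f j (conj w))`. -/
noncomputable def polarization {ι : Type*} [Fintype ι] (f : ι → ℂ[X]) (z : ℂ) : ℂ[X] :=
  ∑ j, C ((f j).eval z) * (f j).map (starRingEnd ℂ)

/-- The coefficient of `w ^ i` in `polarization f z`, as a polynomial in `z`. -/
noncomputable def polarizationCoeff {ι : Type*} [Fintype ι] (f : ι → ℂ[X]) (i : ℕ) : ℂ[X] :=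
  ∑ j, C ((starRingEnd ℂ) ((f j).coeff i)) * f j

section

variable {ι : Type*} [Fintype ι] (f : ι → ℂ[X])

lemma coeff_polarization (z : ℂ) (i : ℕ) :
    (polarization f z).coeff i = (polarizationCoeff f i).eval z := by
  simp [polarization, polarizationCoeff, eval_finsetSum, mul_comm]

lemma coeff_polarizationCoeff_self (i : ℕ) :
    (polarizationCoeff f i).coeff i = ((∑ j, ‖(f j).coeff i‖ ^ 2 : ℝ) : ℂ) := by
  simp [polarizationCoeff, conj_mul']

lemma eval_conj_polarization (z : ℂ) :
    (polarization f z).eval ((starRingEnd ℂ) z) = ((∑ j, ‖(f j).eval z‖ ^ 2 : ℝ) : ℂ) := by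
  simp [polarization, eval_finsetSum, eval_map, eval₂_at_apply, mul_conj']

lemma natDegree_polarization_le {n : ℕ} (hdeg : ∀ j, (f j).natDegree ≤ n) (z : ℂ) :
    (polarization f z).natDegree ≤ n :=
  natDegree_sum_le_of_forall_le _ _ fun j _ =>
    (natDegree_C_mul_le _ _).trans (natDegree_map_le.trans (hdeg j))

lemma natDegree_polarizationCoeff_le {n : ℕ} (hdeg : ∀ j, (f j).natDegree ≤ n) (i : ℕ) :
    (polarizationCoeff f i).natDegree ≤ n :=
  natDegree_sum_le_of_forall_le _ _ fun j _ => (natDegree_C_mul_le _ _).trans (hdeg j)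

lemma polarization_dvd {n : ℕ} (P : MvPolynomial (Fin 2) ℂ)
    (hP : ∀ z : ℂ, MvPolynomial.eval ![z, (starRingEnd ℂ) z] P *
      (∑ j, (f j).eval z * (starRingEnd ℂ) ((f j).eval z)) = (1 + z * (starRingEnd ℂ) z) ^ n)
    (z : ℂ) : polarization f z ∣ (1 + C z * X) ^ n := by
  let Q : MvPolynomial (Fin 2) ℂ := ∑ j, aeval (MvPolynomial.X 0) (f j) *
    aeval (MvPolynomial.X 1) ((f j).map (starRingEnd ℂ))
  have eval_aeval (v : Fin 2 → ℂ) (i : Fin 2) (p : ℂ[X]) :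
      MvPolynomial.eval v (aeval (MvPolynomial.X i) p) = p.eval (v i) := by
    rw [← MvPolynomial.coe_aeval_eq_eval, RingHom.coe_coe, ← aeval_algHom_apply]
    simp [coe_aeval_eq_eval]
  have hzero : P * Q - (1 + MvPolynomial.X 0 * MvPolynomial.X 1) ^ n = 0 := by
    refine mvPolynomial_eq_zero_of_eval_conj _ fun z => ?_
    simp [Q, eval_aeval, eval_map, eval₂_at_apply, hP]
  refine Dvd.intro_left (MvPolynomial.aeval ![C z, X] P) (Polynomial.funext fun w => ?_)
  have hw := congrArg (MvPolynomial.eval ![z, w]) hzero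
  have hPw : (MvPolynomial.aeval ![C z, X] P : ℂ[X]).eval w = MvPolynomial.eval ![z, w] P := by
    rw [← coe_aeval_eq_eval, MvPolynomial.comp_aeval_apply,
      ← MvPolynomial.coe_aeval_eq_eval, RingHom.coe_coe]
    congr 2
    funext i
    fin_cases i <;> simp
  simp only [map_sub, map_mul, map_pow, map_add, map_one, MvPolynomial.eval_X, Q, map_sum,
    eval_aeval, map_zero, sub_eq_zero] at hw
  simpa [hPw, polarization, eval_finsetSum] using hw

/-- If every `f j` has degree at most two, not all less than two, and `polarization f z` divides
a power of `1 + z w`, then it is a constant multiple of `(1 + z w) ^ 2`. -/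
lemma exists_polarization_eq (hdeg : ∀ j, (f j).natDegree ≤ 2)
    (hlead : ∑ j, ‖(f j).coeff 2‖ ^ 2 ≠ 0) {n : ℕ}
    (hdvd : ∀ z, polarization f z ∣ (1 + C z * X) ^ n) :
    ∃ m : ℂ, ∀ z, polarization f z = C m * (1 + C z * X) ^ 2 := by
  let q := polarizationCoeff f
  have hq2 : q 2 ≠ 0 := fun h => hlead <| by
    have := coeff_polarizationCoeff_self f 2
    rw [show polarizationCoeff f 2 = 0 from h, coeff_zero] at this
    exact_mod_cast this.symm
  have hgen (z : ℂ) (hz : z ≠ 0) (hz2 : (q 2).eval z ≠ 0) :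
      (q 1).eval z = 2 * z * (q 0).eval z ∧ (q 2).eval z = z ^ 2 * (q 0).eval z := by
    have hnat : (polarization f z).natDegree = 2 :=
      natDegree_eq_of_le_of_coeff_ne_zero (natDegree_polarization_le f hdeg z)
        (by rwa [coeff_polarization])
    obtain ⟨u, hu⟩ := eq_C_mul_sq_of_dvd_pow hz hnat (hdvd z)
    have hu' : polarization f z = C u + C (2 * z * u) * X + C (z ^ 2 * u) * X ^ 2 := by
      rw [hu]
      simp only [C_mul, C_pow, C_ofNat]
      ring
    simp only [q, ← coeff_polarization, hu']
    constructor <;> simp only [coeff_add, coeff_C_mul, coeff_X_pow] <;> simp [coeff_X, coeff_C]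
  have hext (p : ℂ[X]) (hp : ∀ z, z ≠ 0 → (q 2).eval z ≠ 0 → p.eval z = 0) : p = 0 := by
    have : X * q 2 * p = 0 := Polynomial.funext fun z => by
      by_cases hz : z = 0
      · simp [hz]
      by_cases hz2 : (q 2).eval z = 0
      · simp [hz2]
      simp [hp z hz hz2]
    exact (mul_eq_zero.1 this).resolve_left (mul_ne_zero X_ne_zero hq2)
  have h1 : q 1 = 2 * X * q 0 := sub_eq_zero.1 <| hext _ fun z hz hz2 => by
    simp [(hgen z hz hz2).1]
  have h2 : q 2 = X ^ 2 * q 0 := sub_eq_zero.1 <| hext _ fun z hz hz2 => by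
    simp [(hgen z hz hz2).2]
  have hq0 : q 0 ≠ 0 := fun h => hq2 (by rw [h2, h, mul_zero])
  have hconst : (q 0).natDegree = 0 := by
    have := natDegree_polarizationCoeff_le f hdeg 2
    rw [show polarizationCoeff f 2 = X ^ 2 * q 0 from h2,
      natDegree_mul (pow_ne_zero 2 X_ne_zero) hq0, natDegree_X_pow] at this
    omega
  obtain ⟨m, hm⟩ := natDegree_eq_zero.1 hconst
  refine ⟨m, fun z => ?_⟩
  rw [(polarization f z).as_sum_range_C_mul_X_pow' (n := 3)
    (Nat.lt_succ_of_le (natDegree_polarization_le f hdeg z))]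
  have e0 : (polarizationCoeff f 0).eval z = m := by
    rw [show polarizationCoeff f 0 = C m from hm.symm, eval_C]
  have e1 : (polarizationCoeff f 1).eval z = 2 * z * m := by
    rw [show polarizationCoeff f 1 = _ from h1, ← hm]; simp
  have e2 : (polarizationCoeff f 2).eval z = z ^ 2 * m := by
    rw [show polarizationCoeff f 2 = _ from h2, ← hm]; simp [mul_comm m]
  simp only [Finset.sum_range_succ, Finset.sum_range_zero, coeff_polarization, e0, e1, e2, C_mul,
    C_pow, C_ofNat]
  ring

end

theorem stmt_15 (f : Fin 6 → Polynomial ℂ)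
    (hdeg : ∀ j, (f j).natDegree ≤ 2)
    (hnz : ∀ z : ℂ, ∃ j, (f j).eval z ≠ 0)
    (hlead : ∑ j : Fin 6, ‖(f j).coeff 2‖ ^ 2 ≠ 0)
    (P : MvPolynomial (Fin 2) ℂ)
    (hP : ∀ z : ℂ,
      MvPolynomial.eval ![z, (starRingEnd ℂ) z] P *
        (∑ j : Fin 6, (f j).eval z * (starRingEnd ℂ) ((f j).eval z)) =
      (1 + z * (starRingEnd ℂ) z) ^ 4) :
    ∃ μ : ℝ, 0 < μ ∧
      ∀ z : ℂ, ∑ j : Fin 6, ‖(f j).eval z‖ ^ 2 = μ * (1 + ‖z‖ ^ 2) ^ 2 := by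
  obtain ⟨m, hm⟩ := exists_polarization_eq f hdeg hlead (polarization_dvd f P hP)
  have hnorm (z : ℂ) :
      ((∑ j, ‖(f j).eval z‖ ^ 2 : ℝ) : ℂ) = m * (1 + (‖z‖ : ℂ) ^ 2) ^ 2 := by
    rw [← eval_conj_polarization, hm, ← mul_conj']
    simp
  have hm0 : m = ((∑ j, ‖(f j).eval 0‖ ^ 2 : ℝ) : ℂ) := by
    rw [hnorm]
    simp
  refine ⟨∑ j, ‖(f j).eval 0‖ ^ 2, ?_, fun z => ?_⟩
  · obtain ⟨j, hj⟩ := hnz 0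
    exact Finset.sum_pos' (fun _ _ => by positivity) ⟨j, Finset.mem_univ j, by positivity⟩
  · have h := hnorm z
    rw [hm0] at h
    exact_mod_cast h
end
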